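/- Let P ∈ ℂ[z₁,…,zₙ] be a homogeneous polynomial of degree k ≥ 2 with an isolated singularity at 0 ∈ ℂⁿ, and let F_ℂ(z,w) = ½(P(z) + P(w)) + H_ℂ(z,w), where H_ℂ is a holomorphic germ at 0 ∈ ℂ^{2n} whose Taylor series has no terms of total degree ≤ k. Then the singular set of the germ of hypersurface M_ℂ = {F_ℂ = 0}, namely {F_ℂ = 0} ∩ {dF_ℂ = 0}, is exactly {0}. -/

import Mathlib

open MvPolynomial Filter

theorem aux_hasFDerivAt_eval {n : ℕ} (Q : MvPolynomial (Fin n) ℂ) (z : Fin n → ℂ) :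
    HasFDerivAt (fun z : Fin n → ℂ => eval z Q)
      (∑ i, eval z (pderiv i Q) • (ContinuousLinearMap.proj (R := ℂ) (φ := fun _ : Fin n => ℂ) i)) z := by
  induction Q using MvPolynomial.induction_on with
  | C a => 
    simp only [eval_C, pderiv_C, map_zero]
    refine (hasFDerivAt_const (𝕜 := ℂ) a z).congr_fderiv ?_
    ext v
    simp
  | add p q hp hq =>
    simp only [map_add]
    refine (hp.add hq).congr_fderiv ?_
    ext v
    simp [add_mul, Finset.sum_add_distrib]
  | mul_X p j hp =>
    have hX : HasFDerivAt (fun z : Fin n → ℂ => z j)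
      (ContinuousLinearMap.proj (R := ℂ) (φ := fun _ : Fin n => ℂ) j) z :=
      (ContinuousLinearMap.proj (R := ℂ) (φ := fun _ : Fin n => ℂ) j).hasFDerivAt
    have h := hp.mul hX
    simp only [eval_mul, eval_X]
    refine h.congr_fderiv ?_
    ext v
    simp [pderiv_mul, pderiv_X, Pi.single_apply, add_mul, Finset.sum_add_distrib, Finset.mul_sum,
      apply_ite (eval z)]
    refine Finset.sum_congr rfl fun i _ => ?_
    ring

theorem aux_eval_smul {n m : ℕ} {Q : MvPolynomial (Fin n) ℂ} (hQ : Q.IsHomogeneous m) (c : ℂ)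
    (z : Fin n → ℂ) : eval (c • z) Q = c ^ m * eval z Q := by
  rw [eval_eq', eval_eq', Finset.mul_sum]
  refine Finset.sum_congr rfl fun d hd => ?_
  have h := hQ (mem_support_iff.1 hd)
  have h2 : ∑ i, d i = m := by
    rw [← h, Finsupp.weight_apply, Finsupp.sum_fintype] <;> simp
  simp only [Pi.smul_apply, smul_eq_mul, mul_pow, Finset.prod_mul_distrib]
  rw [Finset.prod_pow_eq_pow_sum, h2]
  ring

theorem aux_bigO {E G : Type} [NormedAddCommGroup E] [NormedSpace ℂ E] [NormedAddCommGroup G]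
    [NormedSpace ℂ G] [CompleteSpace G] {f : E → G} (hf : AnalyticAt ℂ f 0) (k : ℕ)
    (h : ∀ m < k, iteratedFDeriv ℂ m f 0 = 0) :
    f =O[nhds 0] fun y => ‖y‖ ^ k := by
  obtain ⟨p, hp⟩ := hf
  have h1 := hp.isBigO_sub_partialSum_pow k
  obtain ⟨r, hr⟩ := hp
  have h2 : ∀ y, p.partialSum k y = 0 := by
    intro y
    refine Finset.sum_eq_zero fun m hm => ?_
    have h3 := hr.factorial_smul y m
    rw [h m (Finset.mem_range.1 hm)] at h3
    have h4 : (m.factorial : ℂ) • (p m fun _ => y) = 0 := by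
      rw [Nat.cast_smul_eq_nsmul]; simpa using h3
    exact (smul_eq_zero.1 h4).resolve_left (by exact_mod_cast m.factorial_ne_zero)
  simpa [h2] using h1

/-- Let `P` be homogeneous of degree `k ≥ 2` with an isolated singularity at
`0 ∈ ℂⁿ`, and `F_ℂ(z,w) = ½(P(z)+P(w)) + H_ℂ(z,w)` with `H_ℂ` a holomorphic germ
whose Taylor series has no terms of total degree `≤ k`. Then the singular set of
the germ `M_ℂ = {F_ℂ = 0}`, namely `{F_ℂ = 0} ∩ {dF_ℂ = 0}`, is exactly `{0}`. -/
theorem stmt10 (n k : ℕ) (hn : 1 ≤ n) (hk : 2 ≤ k)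
    (P : MvPolynomial (Fin n) ℂ) (hP : P.IsHomogeneous k)
    (hiso : {z : Fin n → ℂ | ∀ i, eval z (pderiv i P) = 0} = {0})
    (H : (Fin n → ℂ) × (Fin n → ℂ) → ℂ)
    (hH : AnalyticAt ℂ H 0)
    (hHk : ∀ m : ℕ, m ≤ k → iteratedFDeriv ℂ m H 0 = 0)
    (F : (Fin n → ℂ) × (Fin n → ℂ) → ℂ)
    (hF : F = fun p => (eval p.1 P + eval p.2 P) / 2 + H p) :
    ∀ᶠ p in nhds (0 : (Fin n → ℂ) × (Fin n → ℂ)),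
      (F p = 0 ∧ fderiv ℂ F p = 0) ↔ p = 0 := by
  set G : (Fin n → ℂ) × (Fin n → ℂ) → (Fin n → ℂ) × (Fin n → ℂ) := fun p =>
    (fun i => eval p.1 (pderiv i P), fun i => eval p.2 (pderiv i P)) with hG
  have hGc : Continuous G := by
    have hc : ∀ i, Continuous fun z : Fin n → ℂ => eval z (pderiv i P) := fun i =>
      MvPolynomial.continuous_eval _
    exact (continuous_pi fun i => (hc i).comp continuous_fst).prodMk
      (continuous_pi fun i => (hc i).comp continuous_snd)
  have hGs : ∀ (c : ℂ) p, G (c • p) = c ^ (k - 1) • G p := by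
    intro c p
    ext i <;> simp [hG, aux_eval_smul (hP.pderiv (i := i))]
  have hz : ∀ z : Fin n → ℂ, (∀ i, eval z (pderiv i P) = 0) ↔ z = 0 := fun z => by
    have := Set.ext_iff.1 hiso z
    simpa using this
  have hG0 : ∀ p, G p = 0 → p = 0 := by
    intro p hp
    have h1 := (hz p.1).1 fun i => congrFun (congrArg Prod.fst hp) i
    have h2 := (hz p.2).1 fun i => congrFun (congrArg Prod.snd hp) i
    exact Prod.ext h1 h2
  -- lower bound
  obtain ⟨c, hc, hlow⟩ : ∃ c > 0, ∀ p, c * ‖p‖ ^ (k - 1) ≤ ‖G p‖ := by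
    have : Nonempty (Fin n) := ⟨⟨0, hn⟩⟩
    have hne : (Metric.sphere (0 : (Fin n → ℂ) × (Fin n → ℂ)) 1).Nonempty := by
      have : Nontrivial ((Fin n → ℂ) × (Fin n → ℂ)) := inferInstance
      refine ⟨(fun _ => 1, fun _ => 0), ?_⟩
      simp [Prod.norm_def, pi_norm_const]
    obtain ⟨q, hq, hmin⟩ := (isCompact_sphere (0 : (Fin n → ℂ) × (Fin n → ℂ)) 1).exists_isMinOn
      hne hGc.norm.continuousOn
    refine ⟨‖G q‖, norm_pos_iff.2 fun h => ?_, fun p => ?_⟩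
    · rw [hG0 q h] at hq
      simp at hq
    · by_cases hp : p = 0
      · subst hp
        rw [norm_zero, zero_pow (by omega), mul_zero]
        exact norm_nonneg _
      · have hp' : 0 < ‖p‖ := norm_pos_iff.2 hp
        have hs : ((‖p‖ : ℂ)⁻¹ • p) ∈ Metric.sphere (0 : (Fin n → ℂ) × (Fin n → ℂ)) 1 := by
          simp [norm_smul, hp'.ne']
        have h := hmin hs
        simp only [Set.mem_ofPred_eq, hGs, norm_smul, norm_pow, norm_inv, Complex.norm_real,
          norm_norm] at h
        rw [inv_pow, inv_mul_eq_div, le_div_iff₀ (pow_pos hp' _)] at h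
        exact h
  -- upper bound
  have hup : (fderiv ℂ H) =O[nhds 0] fun y => ‖y‖ ^ k := by
    refine aux_bigO hH.fderiv k fun m hm => ?_
    rw [← norm_eq_zero, norm_iteratedFDeriv_fderiv, hHk (m + 1) hm, norm_zero]
  obtain ⟨C, hC, hup⟩ := hup.exists_pos
  have hup := hup.bound
  have hFd : ∀ p, DifferentiableAt ℂ H p → ∀ v : (Fin n → ℂ) × (Fin n → ℂ),
      fderiv ℂ F p v = (∑ i, (G p).1 i * v.1 i + ∑ i, (G p).2 i * v.2 i) / 2
        + fderiv ℂ H p v := by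
    intro p hp v
    have h1 := (aux_hasFDerivAt_eval P p.1).comp p (hasFDerivAt_fst (𝕜 := ℂ))
    have h2 := (aux_hasFDerivAt_eval P p.2).comp p (hasFDerivAt_snd (𝕜 := ℂ))
    have h3 := ((h1.add h2).mul_const (2⁻¹ : ℂ)).add hp.hasFDerivAt
    have hF' : F = (fun y => (((fun z => eval z P) ∘ Prod.fst + (fun z => eval z P) ∘ Prod.snd :
        (Fin n → ℂ) × (Fin n → ℂ) → ℂ)) y
        * (2⁻¹ : ℂ)) + H := by
      rw [hF]
      funext q
      simp [div_eq_mul_inv]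
    rw [hF', h3.fderiv]
    simp [hG]
    ring
  have hH0 : H 0 = 0 := by
    rw [← norm_eq_zero, ← norm_iteratedFDeriv_zero (𝕜 := ℂ), hHk 0 (Nat.zero_le _), norm_zero]
  have hH1 : fderiv ℂ H 0 = 0 := by
    have := hHk 1 (by omega)
    rw [← norm_eq_zero, ← norm_iteratedFDeriv_one, this, norm_zero]
  have hsmall : ∀ᶠ p in nhds (0 : (Fin n → ℂ) × (Fin n → ℂ)), ‖p‖ < c / (2 * C) := by
    have := Metric.ball_mem_nhds (0 : (Fin n → ℂ) × (Fin n → ℂ)) (ε := c / (2 * C)) (by positivity)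
    filter_upwards [this] with p hp
    simpa using hp
  filter_upwards [hup, hsmall, hH.eventually_analyticAt] with p hp1 hp2 hp3
  constructor
  · rintro ⟨-, hd⟩
    by_contra hne
    have hp' : 0 < ‖p‖ := norm_pos_iff.2 hne
    have hv : ∀ v : (Fin n → ℂ) × (Fin n → ℂ),
        ∑ i, (G p).1 i * v.1 i + ∑ i, (G p).2 i * v.2 i = - 2 * fderiv ℂ H p v := by
      intro v
      have h := hFd p hp3.differentiableAt v
      rw [hd] at h
      simp only [zero_apply] at h
      linear_combination (-2) * h
    have hb : ∀ v : (Fin n → ℂ) × (Fin n → ℂ), ‖v‖ ≤ 1 →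
        ‖- 2 * fderiv ℂ H p v‖ ≤ 2 * ‖fderiv ℂ H p‖ := by
      intro v hv1
      rw [norm_mul, norm_neg, Complex.norm_ofNat]
      have := (fderiv ℂ H p).le_opNorm v
      nlinarith [norm_nonneg (fderiv ℂ H p)]
    have hs1 : ∀ i : Fin n, ‖(Pi.single i 1 : Fin n → ℂ)‖ ≤ 1 := by
      intro i
      refine (pi_norm_le_iff_of_nonneg zero_le_one).2 fun j => ?_
      by_cases hij : j = i <;> simp [Pi.single_apply, hij]
    have hGn : ‖G p‖ ≤ 2 * ‖fderiv ℂ H p‖ := by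
      have hnn : 0 ≤ 2 * ‖fderiv ℂ H p‖ := by positivity
      refine norm_prod_le_iff.2 ⟨(pi_norm_le_iff_of_nonneg hnn).2 fun i => ?_,
        (pi_norm_le_iff_of_nonneg hnn).2 fun i => ?_⟩
      · have h1 := hv (Pi.single i 1, 0)
        have h2 := hb (Pi.single i 1, 0) (by simp [Prod.norm_def, hs1])
        rw [← h1] at h2
        simpa [Pi.single_apply] using h2
      · have h1 := hv (0, Pi.single i 1)
        have h2 := hb (0, Pi.single i 1) (by simp [Prod.norm_def, hs1])
        rw [← h1] at h2
        simpa [Pi.single_apply] using h2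
    have hl := hlow p
    rw [norm_pow, norm_norm] at hp1
    have hk' : ‖p‖ ^ k = ‖p‖ ^ (k - 1) * ‖p‖ := by
      rw [← pow_succ]; congr 1; omega
    rw [hk'] at hp1
    rw [lt_div_iff₀ (by positivity)] at hp2
    have hpp : 0 < ‖p‖ ^ (k - 1) := pow_pos hp' _
    nlinarith [mul_lt_mul_of_pos_left hp2 hpp]
  · rintro rfl
    have hP0 : eval (0 : Fin n → ℂ) P = 0 := by
      have := aux_eval_smul hP 0 0
      rw [zero_smul, zero_pow (by omega), zero_mul] at this
      exact this
    have hG00 : G 0 = 0 := by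
      have := hGs 0 0
      rw [zero_smul, zero_pow (by omega), zero_smul] at this
      exact this
    refine ⟨by simp only [hF, Prod.fst_zero, Prod.snd_zero, hP0, hH0]; simp, ?_⟩
    refine ContinuousLinearMap.ext fun v => ?_
    rw [hFd 0 hH.differentiableAt v, hG00, hH1]
    simp
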